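/- arXiv:1305.0722 — 5 statements merged into one kernel-verified Lean document; each statement's English description precedes it below -/
import Mathlib

section
/- For every positive irrational real number τ there exists a constant C = C(τ) > 0 such that for all integers k ≥ 1 one has ∏_{l=1}^{q_k − 1} |sec(π l τ)| ≤ C · 6^{q_k}, where q_k denotes the denominator of the k-th convergent of the continued fraction expansion of 2τ. -/
open Real Filter Finset

/-- The complete quotients of the continued fraction expansion of `x`:
`g 0 = x`, and `g (n+1) = 1 / Int.fract (g n)`. -/
noncomputable def contFracQuot (x : ℝ) : ℕ → ℝ
  | 0 => x
  | n + 1 => (Int.fract (contFracQuot x n))⁻¹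

/-- The partial quotients `a n` of the continued fraction expansion of `x`. -/
noncomputable def contFracA (x : ℝ) (n : ℕ) : ℤ := ⌊contFracQuot x n⌋

/-- The denominators `q n` of the convergents of the continued fraction expansion of `x`,
satisfying `q 0 = 1`, `q 1 = a 1`, and `q (n+2) = a (n+2) * q (n+1) + q n`
(i.e. the recurrence `qₙ = aₙ qₙ₋₁ + qₙ₋₂` with `q₋₁ = 0`, `q₋₂ = 1`). -/
noncomputable def contFracQ (x : ℝ) : ℕ → ℤ
  | 0 => 1
  | 1 => contFracA x 1
  | n + 2 => contFracA x (n + 2) * contFracQ x (n + 1) + contFracQ x n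

theorem prod_two_mul_sin_eq (n : ℕ) :
    ∏ r ∈ Finset.Ico 1 (n + 1), (2 * Real.sin (π * (r / (n + 1 : ℕ)))) = (n + 1 : ℕ) := by
  have h := (Complex.isPrimitiveRoot_exp (n + 1) n.succ_ne_zero).prod_one_sub_pow_eq_order
  have h2 := congrArg norm h
  rw [norm_prod] at h2
  have h3 : ‖((n : ℂ) + 1)‖ = ((n + 1 : ℕ) : ℝ) := by
    rw [← Complex.norm_natCast]; push_cast; rfl
  rw [h3] at h2
  refine Eq.trans ?_ h2
  rw [Finset.prod_Ico_eq_prod_range]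
  refine Finset.prod_congr rfl fun k hk => ?_
  have hk' : k < n := by simpa using hk
  rw [norm_sub_rev, ← Complex.exp_nat_mul]
  have e : ((k + 1 : ℕ) : ℂ) * (2 * π * Complex.I / (n + 1 : ℕ))
      = Complex.I * ((2 * (π * ((1 + k : ℕ) / (n + 1 : ℕ))) : ℝ) : ℂ) := by
    push_cast; ring
  rw [e, Complex.norm_exp_I_mul_ofReal_sub_one, Real.norm_eq_abs, mul_div_cancel_left₀ _ two_ne_zero,
    abs_of_nonneg]
  refine mul_nonneg zero_le_two (Real.sin_nonneg_of_nonneg_of_le_pi (by positivity) ?_)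
  refine mul_le_of_le_one_right pi_pos.le (div_le_one_of_le₀ ?_ (by positivity))
  exact_mod_cast (by omega : 1 + k ≤ n + 1)

theorem sin_pi_mul_le_sin_pi_mul {a y : ℝ} (ha : 0 ≤ a) (h1 : a ≤ y) (h2 : y ≤ 1 - a) :
    Real.sin (π * a) ≤ Real.sin (π * y) := by
  have hp := pi_pos
  rcases le_total y (1 / 2) with h | h
  · exact Real.sin_le_sin_of_le_of_le_pi_div_two (by nlinarith) (by nlinarith) (by nlinarith)
  · rw [← Real.sin_pi_sub (π * y)]
    exact Real.sin_le_sin_of_le_of_le_pi_div_two (by nlinarith) (by nlinarith) (by nlinarith)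

/-- A lower bound for `sin (π y)` valid for `r / q ≤ y ≤ (r + 1) / q`, and, when `r = q - 1`,
under the further condition `y ≤ 1 - 1 / q ^ 2`. -/
noncomputable def sinCellBound (q r : ℕ) : ℝ :=
  if r < q / 2 then Real.sin (π * (r / q))
  else if r + 1 < q then Real.sin (π * ((r + 1 : ℕ) / q))
  else 2 / (q : ℝ) ^ 2

theorem sin_pi_mul_div_nonneg {q r : ℕ} (h : r ≤ q) : 0 ≤ Real.sin (π * (r / q)) := by
  refine Real.sin_nonneg_of_nonneg_of_le_pi (by positivity) ?_
  exact mul_le_of_le_one_right pi_pos.le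
    (div_le_one_of_le₀ (by exact_mod_cast h) (by positivity))

theorem sinCellBound_nonneg {q r : ℕ} : 0 ≤ sinCellBound q r := by
  unfold sinCellBound
  split_ifs
  · exact sin_pi_mul_div_nonneg (by omega)
  · exact sin_pi_mul_div_nonneg (by omega)
  · positivity

theorem sinCellBound_le {q r : ℕ} (hr : 1 ≤ r) (hrq : r < q) {y : ℝ}
    (h1 : (r : ℝ) / q ≤ y) (h2 : y ≤ (r + 1) / q) (h3 : y ≤ r / q + (q - 1) / (q : ℝ) ^ 2) :
    sinCellBound q r ≤ Real.sin (π * y) := by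
  have hq : (0 : ℝ) < q := by exact_mod_cast (by omega : 0 < q)
  unfold sinCellBound
  split_ifs with ha hb
  · refine sin_pi_mul_le_sin_pi_mul (by positivity) h1 (h2.trans ?_)
    rw [div_le_iff₀ hq, sub_mul, div_mul_cancel₀ _ hq.ne']
    have : (2 * r + 1 : ℝ) ≤ q := by exact_mod_cast (by omega : 2 * r + 1 ≤ q)
    linarith
  · have e : π * (((r + 1 : ℕ) : ℝ) / q) = π - π * (1 - (r + 1) / q) := by push_cast; ring
    rw [e, Real.sin_pi_sub]
    refine sin_pi_mul_le_sin_pi_mul ?_ (le_trans ?_ h1) (by linarith)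
    · rw [sub_nonneg, div_le_one hq]
      exact_mod_cast hrq
    · rw [sub_le_iff_le_add, ← add_div, le_div_iff₀ hq]
      have : (q : ℝ) ≤ 2 * r + 1 := by exact_mod_cast (by omega : q ≤ 2 * r + 1)
      linarith
  · have e : (r : ℝ) = q - 1 := by
      have : q = r + 1 := by omega
      rw [this]; push_cast; ring
    have hq2 : (2 : ℝ) ≤ q := by exact_mod_cast (by omega : 2 ≤ q)
    have hsq : (1 : ℝ) / q ^ 2 ≤ 1 / 2 := by
      apply one_div_le_one_div_of_le <;> nlinarith
    refine le_trans ?_ (sin_pi_mul_le_sin_pi_mul (a := 1 / (q : ℝ) ^ 2) (by positivity)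
      (le_trans ?_ h1) (h3.trans ?_))
    · have := Real.mul_le_sin (x := π * (1 / (q : ℝ) ^ 2)) (by positivity) (by nlinarith [pi_pos])
      refine le_trans (le_of_eq ?_) this
      field_simp
    · rw [e, div_le_div_iff₀ (by positivity) hq]
      nlinarith [mul_nonneg hq.le (sub_nonneg.2 hq2), mul_pos hq hq]
    · rw [e]
      apply le_of_eq
      field_simp
      ring

theorem le_prod_sinCellBound {q : ℕ} (hq : 2 ≤ q) :
    4 ≤ q * 2 ^ q * ∏ r ∈ Finset.Ico 1 q, sinCellBound q r := by
  obtain ⟨n, rfl⟩ : ∃ n, q = n + 2 := ⟨q - 2, by omega⟩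
  set q := n + 2 with hqdef
  set m := q / 2
  set s : ℕ → ℝ := fun r => Real.sin (π * (r / q))
  have hq0 : (0 : ℝ) < q := by exact_mod_cast (by omega : 0 < q)
  have hprod : 2 ^ (n + 1) * ∏ r ∈ Finset.Ico 1 q, s r = q := by
    have := prod_two_mul_sin_eq (n + 1)
    rw [Finset.prod_mul_distrib, Finset.prod_const, Nat.card_Ico] at this
    exact this
  have hF : ∏ r ∈ Finset.Ico 1 q, sinCellBound q r
      = (∏ r ∈ Finset.Ico 1 m, s r) * (∏ r ∈ Finset.Ico (m + 1) q, s r) * (2 / (q : ℝ) ^ 2) := by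
    rw [show q = (n + 1) + 1 from rfl, Finset.prod_Ico_succ_top (by omega),
      ← Finset.prod_Ico_consecutive _ (show 1 ≤ m by omega) (show m ≤ n + 1 by omega),
      ← Finset.prod_Ico_add' s m (n + 1) 1]
    congr 1
    · congr 1
      · refine Finset.prod_congr rfl fun r hr => ?_
        rw [Finset.mem_Ico] at hr
        exact if_pos (by omega)
      · refine Finset.prod_congr rfl fun r hr => ?_
        rw [Finset.mem_Ico] at hr
        unfold sinCellBound
        rw [if_neg (by omega), if_pos (by omega)]
    · unfold sinCellBound
      rw [if_neg (by omega), if_neg (by omega)]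
  have hle : ∏ r ∈ Finset.Ico 1 q, s r
      ≤ (∏ r ∈ Finset.Ico 1 m, s r) * (∏ r ∈ Finset.Ico (m + 1) q, s r) := by
    rw [← Finset.prod_Ico_consecutive _ (show 1 ≤ m by omega) (show m ≤ q by omega),
      Finset.prod_eq_prod_Ico_succ_bot (show m < q by omega)]
    refine mul_le_mul_of_nonneg_left (mul_le_of_le_one_left ?_ (Real.sin_le_one _)) ?_ <;>
    · refine Finset.prod_nonneg fun r hr => sin_pi_mul_div_nonneg ?_
      rw [Finset.mem_Ico] at hr
      omega
  rw [hF]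
  calc (4 : ℝ) = q * (2 * (2 ^ (n + 1) * ∏ r ∈ Finset.Ico 1 q, s r)) * (2 / (q : ℝ) ^ 2) := by
        rw [hprod]; field_simp; norm_num
    _ = q * 2 ^ q * ((∏ r ∈ Finset.Ico 1 q, s r) * (2 / (q : ℝ) ^ 2)) := by
        rw [show q = (n + 1) + 1 from rfl, pow_succ (2 : ℝ) (n + 1)]; ring
    _ ≤ _ := by gcongr

theorem le_prod_abs_sin_of_nonneg {q : ℕ} (hq : 2 ≤ q) {p : ℤ} (hc : IsCoprime p (q : ℤ)) {x : ℝ}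
    (h0 : 0 ≤ x - p / q) (h1 : x - p / q ≤ 1 / (q : ℝ) ^ 2) :
    4 ≤ q * 2 ^ q * ∏ l ∈ Finset.Ico 1 q, |Real.sin (π * (l * x))| := by
  refine (le_prod_sinCellBound hq).trans (mul_le_mul_of_nonneg_left ?_ (by positivity))
  have hq0 : (0 : ℝ) < q := by exact_mod_cast (by omega : 0 < q)
  have hqz : (0 : ℤ) < q := by omega
  set f : ℕ → ℕ := fun l => ((l * p) % (q : ℤ)).toNat with hf
  have hfz : ∀ l, (f l : ℤ) = (l * p) % (q : ℤ) := fun l =>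
    Int.toNat_of_nonneg (Int.emod_nonneg _ hqz.ne')
  have hmaps : ∀ l ∈ Finset.Ico 1 q, f l ∈ Finset.Ico 1 q := by
    intro l hl
    rw [Finset.mem_Ico] at hl ⊢
    have hlt := Int.emod_lt_of_pos (l * p) hqz
    rw [← hfz] at hlt
    refine ⟨?_, by omega⟩
    by_contra h
    have h0 : (l * p) % (q : ℤ) = 0 := by rw [← hfz]; omega
    have hd := hc.symm.dvd_of_dvd_mul_right (Int.dvd_of_emod_eq_zero h0)
    have := Int.le_of_dvd (by omega) hd
    omega
  have hinj : Set.InjOn f (Finset.Ico 1 q) := by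
    intro a ha b hb hab
    rw [Finset.mem_coe, Finset.mem_Ico] at ha hb
    have h : (a * p) % (q : ℤ) = (b * p) % (q : ℤ) := by rw [← hfz, ← hfz, hab]
    have hd : (q : ℤ) ∣ (a - b) * p := by
      rw [sub_mul]; exact Int.dvd_of_emod_eq_zero (Int.emod_eq_emod_iff_emod_sub_eq_zero.1 h)
    have := Int.eq_zero_of_abs_lt_dvd (hc.symm.dvd_of_dvd_mul_right hd) (by rw [abs_lt]; omega)
    omega
  have himg : (Finset.Ico 1 q).image f = Finset.Ico 1 q :=
    Finset.eq_of_subset_of_card_le (Finset.image_subset_iff.2 hmaps)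
      (Finset.card_image_of_injOn hinj).ge
  rw [← himg, Finset.prod_image hinj, himg]
  refine Finset.prod_le_prod (fun _ _ => sinCellBound_nonneg) fun l hl => ?_
  have hfl := Finset.mem_Ico.1 (hmaps l hl)
  rw [Finset.mem_Ico] at hl
  have hdec : (l * p : ℝ) = q * ((l * p / (q : ℤ) : ℤ) : ℝ) + f l := by
    have := Int.mul_ediv_add_emod (l * p) q
    rw [← hfz] at this
    exact_mod_cast this.symm
  set c : ℤ := l * p / (q : ℤ)
  set d : ℝ := x - p / q with hd
  have hlx : (l : ℝ) * x = (f l / q + l * d) + c := by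
    rw [hd]; field_simp; linarith
  rw [hlx, mul_add π, mul_comm π (c : ℝ), Real.sin_add_int_mul_pi, abs_mul, abs_zpow, abs_neg,
    abs_one, one_zpow, one_mul]
  have hl1 : (l : ℝ) ≤ q - 1 := by
    have : (l : ℝ) + 1 ≤ q := by exact_mod_cast hl.2
    linarith
  have hb : l * d ≤ (q - 1) / (q : ℝ) ^ 2 := by
    calc l * d ≤ (q - 1) * (1 / (q : ℝ) ^ 2) := by gcongr; exact (Nat.cast_nonneg l).trans hl1
      _ = _ := by ring
  have hb2 : (q - 1) / (q : ℝ) ^ 2 ≤ 1 / q := by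
    rw [div_le_div_iff₀ (by positivity) hq0]; nlinarith
  refine le_trans (sinCellBound_le hfl.1 hfl.2 ?_ ?_ ?_) (le_abs_self _)
  · have : 0 ≤ l * d := by positivity
    linarith
  · rw [add_div]; linarith
  · linarith

theorem le_prod_abs_sin {q : ℕ} (hq : 2 ≤ q) {p : ℤ} (hc : IsCoprime p (q : ℤ)) {x : ℝ}
    (h : |x - p / q| ≤ 1 / (q : ℝ) ^ 2) :
    4 ≤ q * 2 ^ q * ∏ l ∈ Finset.Ico 1 q, |Real.sin (π * (l * x))| := by
  rcases le_total 0 (x - p / q) with h0 | h0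
  · exact le_prod_abs_sin_of_nonneg hq hc h0 (abs_of_nonneg h0 ▸ h)
  · rw [abs_of_nonpos h0] at h
    have := le_prod_abs_sin_of_nonneg hq hc.neg_left (x := -x)
      (by push_cast; rw [neg_div]; linarith) (by push_cast; rw [neg_div]; linarith)
    simpa only [mul_neg, Real.sin_neg, abs_neg] using this

theorem irrational_contFracQuot {x : ℝ} (hx : Irrational x) (n : ℕ) :
    Irrational (contFracQuot x n) := by
  induction n with
  | zero => exact hx
  | succ n ih => exact (ih.sub_intCast _).inv

theorem one_lt_contFracQuot_succ {x : ℝ} (hx : Irrational x) (n : ℕ) :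
    1 < contFracQuot x (n + 1) := by
  have h := irrational_contFracQuot hx n
  exact (one_lt_inv₀ (Int.fract_pos.2 (h.ne_int _))).2 (Int.fract_lt_one _)

theorem contFracQuot_eq {x : ℝ} (hx : Irrational x) (n : ℕ) :
    contFracQuot x n * contFracQuot x (n + 1)
      = contFracA x n * contFracQuot x (n + 1) + 1 := by
  have h0 : Int.fract (contFracQuot x n) ≠ 0 :=
    (Int.fract_pos.2 ((irrational_contFracQuot hx n).ne_int _)).ne'
  have h1 : Int.fract (contFracQuot x n) * contFracQuot x (n + 1) = 1 := mul_inv_cancel₀ h0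
  have h2 : contFracQuot x n = contFracA x n + Int.fract (contFracQuot x n) :=
    (Int.floor_add_fract _).symm
  linear_combination h1 + contFracQuot x (n + 1) * h2

theorem one_le_contFracA_succ {x : ℝ} (hx : Irrational x) (n : ℕ) : 1 ≤ contFracA x (n + 1) :=
  Int.le_floor.2 (by exact_mod_cast (one_lt_contFracQuot_succ hx n).le)

theorem one_le_contFracQ {x : ℝ} (hx : Irrational x) (n : ℕ) : 1 ≤ contFracQ x n := by
  induction n using Nat.twoStepInduction with
  | zero => exact le_rfl
  | one => exact one_le_contFracA_succ hx 0
  | more n h0 h1 =>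
    rw [contFracQ]
    nlinarith [one_le_contFracA_succ hx (n + 1)]

theorem exists_contFrac_numerators {x : ℝ} (hx : Irrational x) (n : ℕ) :
    ∃ p p' : ℤ, |p * contFracQ x n - p' * contFracQ x (n + 1)| = 1 ∧
      x * (contFracQuot x (n + 2) * contFracQ x (n + 1) + contFracQ x n)
        = contFracQuot x (n + 2) * p + p' := by
  induction n with
  | zero =>
    refine ⟨contFracA x 1 * contFracA x 0 + 1, contFracA x 0, ?_, ?_⟩
    · simp only [contFracQ]
      ring_nf
      exact abs_one
    · have h0 := contFracQuot_eq hx 0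
      have h1 := contFracQuot_eq hx 1
      simp only [contFracQ, contFracQuot] at h0 h1 ⊢
      push_cast
      linear_combination (-x + contFracA x 0) * h1 + (Int.fract (Int.fract x)⁻¹)⁻¹ * h0
  | succ n ih =>
    obtain ⟨p, p', h1, h2⟩ := ih
    refine ⟨contFracA x (n + 2) * p + p', p, ?_, ?_⟩
    · rw [contFracQ, ← h1, ← abs_neg]
      congr 1
      ring
    · have h := contFracQuot_eq hx (n + 2)
      rw [show contFracQ x (n + 1 + 1)
        = contFracA x (n + 2) * contFracQ x (n + 1) + contFracQ x n from rfl]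
      push_cast
      linear_combination contFracQuot x (n + 3) * h2 + (p - x * contFracQ x (n + 1)) * h

theorem exists_isCoprime_abs_sub_div_contFracQ_le {x : ℝ} (hx : Irrational x) (n : ℕ) :
    ∃ p : ℤ, IsCoprime p (contFracQ x (n + 1)) ∧
      |x - p / contFracQ x (n + 1)| ≤ 1 / (contFracQ x (n + 1) : ℝ) ^ 2 := by
  obtain ⟨p, p', h1, h2⟩ := exists_contFrac_numerators hx n
  have hg := one_lt_contFracQuot_succ hx (n + 1)
  have hQ : (1 : ℝ) ≤ contFracQ x (n + 1) := by exact_mod_cast one_le_contFracQ hx (n + 1)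
  have hQ' : (1 : ℝ) ≤ contFracQ x n := by exact_mod_cast one_le_contFracQ hx n
  have h1r : |(p : ℝ) * contFracQ x n - p' * contFracQ x (n + 1)| = 1 := by exact_mod_cast h1
  refine ⟨p, ?_, ?_⟩
  · rcases (abs_eq zero_le_one).1 h1 with h | h
    · exact ⟨contFracQ x n, -p', by linear_combination h⟩
    · exact ⟨-contFracQ x n, p', by linear_combination -h⟩
  · set g := contFracQuot x (n + 2)
    set Q : ℝ := (contFracQ x (n + 1) : ℝ)
    set Q' : ℝ := (contFracQ x n : ℝ)
    have hden : Q ≤ g * Q + Q' := by nlinarith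
    have e : x - p / Q = -(p * Q' - p' * Q) / (Q * (g * Q + Q')) := by
      have : 0 < g * Q + Q' := by linarith
      have : 0 < Q := by linarith
      field_simp
      linear_combination Q * h2
    rw [e, abs_div, abs_neg, h1r, abs_of_pos (by nlinarith)]
    apply one_div_le_one_div_of_le (by positivity)
    rw [sq]
    gcongr

theorem abs_inv_cos_le {θ : ℝ} (h : Real.sin (2 * θ) ≠ 0) :
    |(Real.cos θ)⁻¹| ≤ 2 * |Real.sin (2 * θ)|⁻¹ := by
  rw [Real.sin_two_mul] at h ⊢
  have hc : Real.cos θ ≠ 0 := fun h' => h (by rw [h', mul_zero])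
  have hs : Real.sin θ ≠ 0 := fun h' => h (by rw [h', mul_zero, zero_mul])
  rw [abs_mul, abs_mul, abs_two, abs_inv, mul_inv, mul_inv, ← mul_assoc, ← mul_assoc,
    mul_inv_cancel₀ two_ne_zero, one_mul]
  exact le_mul_of_one_le_left (by positivity)
    ((one_le_inv₀ (abs_pos.2 hs)).2 (Real.abs_sin_le_one θ))

/-- For every positive irrational `τ` there is a constant `C > 0` such that
for all `k ≥ 1`, `∏_{l=1}^{q_k - 1} |sec (π l τ)| ≤ C * 6 ^ q_k`, where `q_k` is the
denominator of the `k`-th convergent of `2τ`. -/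
theorem stmt0 (τ : ℝ) (hirr : Irrational τ) (hpos : 0 < τ) :
    ∃ C : ℝ, 0 < C ∧ ∀ k : ℕ, 1 ≤ k →
      ∏ l ∈ Finset.Ico 1 (contFracQ (2 * τ) k).toNat, |(Real.cos (π * l * τ))⁻¹|
        ≤ C * 6 ^ (contFracQ (2 * τ) k).toNat := by
  refine ⟨2, two_pos, fun k hk => ?_⟩
  obtain ⟨n, rfl⟩ : ∃ n, k = n + 1 := ⟨k - 1, by omega⟩
  have hx : Irrational (2 * τ) := by exact_mod_cast hirr.natCast_mul two_ne_zero
  obtain ⟨p, hc, hp⟩ := exists_isCoprime_abs_sub_div_contFracQ_le hx n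
  have hQ := one_le_contFracQ hx (n + 1)
  obtain ⟨q, hq⟩ : ∃ q : ℕ, contFracQ (2 * τ) (n + 1) = q :=
    ⟨_, (Int.toNat_of_nonneg (by omega)).symm⟩
  rw [hq] at hc hp hQ ⊢
  rw [Int.toNat_natCast]
  rw [Int.cast_natCast] at hp
  rcases (by omega : q = 1 ∨ 2 ≤ q) with rfl | hq2
  · norm_num
  have hlow := le_prod_abs_sin hq2 hc hp
  set P := ∏ l ∈ Finset.Ico 1 q, |Real.sin (π * (l * (2 * τ)))| with hP
  have hP0 : P ≠ 0 := by
    intro h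
    rw [h] at hlow
    linarith
  have hPpos : 0 < P := (Finset.prod_nonneg fun _ _ => abs_nonneg _).lt_of_ne' hP0
  have hsin := Finset.prod_ne_zero_iff.1 hP0
  calc ∏ l ∈ Finset.Ico 1 q, |(Real.cos (π * l * τ))⁻¹|
      ≤ ∏ l ∈ Finset.Ico 1 q, (2 * |Real.sin (π * (l * (2 * τ)))|⁻¹) := by
        refine Finset.prod_le_prod (fun _ _ => abs_nonneg _) fun l hl => ?_
        have e : π * (l * (2 * τ)) = 2 * (π * l * τ) := by ring
        have := abs_pos.1 ((abs_nonneg _).lt_of_ne' (hsin l hl))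
        rw [e] at this ⊢
        exact abs_inv_cos_le this
    _ = 2 ^ (q - 1) * P⁻¹ := by
        rw [Finset.prod_mul_distrib, Finset.prod_const, Nat.card_Ico, Finset.prod_inv_distrib]
    _ ≤ 2 ^ q * (q * 2 ^ q) := by
        gcongr
        · exact one_le_two
        · omega
        · rw [inv_le_iff_one_le_mul₀ hPpos]
          linarith
    _ = q * 4 ^ q := by
        rw [show (4 : ℝ) = 2 * 2 by norm_num, mul_pow]; ring
    _ ≤ 2 * (3 / 2) ^ q * 4 ^ q := by
        gcongr
        have := one_add_mul_le_pow (a := (1 / 2 : ℝ)) (by norm_num) q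
        norm_num at this
        linarith
    _ = 2 * 6 ^ q := by
        rw [mul_assoc, ← mul_pow]; norm_num
end

section
/- For every positive irrational real number τ there exist a constant C > 0 and a strictly increasing sequence of positive integers (N_k)_{k ≥ 1} such that ∏_{l=1}^{N_k − 1} |sec(π l τ)| ≤ C · 6^{N_k} for every k ≥ 1. -/
open Real Filter Finset

/-- For a nonnegative monotone `f`, the product of `f` over a finite set of naturals is at least
its product over the initial segment of the same size. -/
theorem prod_range_card_le_prod {f : ℕ → ℝ} (hf : Monotone f) (h0 : ∀ i, 0 ≤ f i)
    (s : Finset ℕ) : ∏ i ∈ range s.card, f i ≤ ∏ i ∈ s, f i := by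
  refine Finset.induction_on_max s (by simp) fun a s hlt ih => ?_
  have ha : a ∉ s := fun h => (hlt a h).false
  have hcard : s.card ≤ a := by
    simpa using card_le_card (fun x hx => mem_range.2 (hlt x hx) : s ⊆ range a)
  rw [card_insert_of_notMem ha, prod_range_succ, prod_insert ha, mul_comm]
  exact mul_le_mul (hf hcard) ih (prod_nonneg fun i _ => h0 i) (h0 a)

/-- An irrational number has Dirichlet approximations of arbitrarily large denominator. -/
theorem Irrational.exists_rat_abs_sub_lt_and_lt_den {τ : ℝ} (hτ : Irrational τ) (B : ℕ) :
    ∃ r : ℚ, |τ - r| < 1 / (r.den : ℝ) ^ 2 ∧ B < r.den := by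
  obtain ⟨ε, hε, hε0⟩ := ((hτ.eventually_forall_le_dist_cast_rat_of_den_le B).filter_mono
    nhdsWithin_le_nhds |>.and (self_mem_nhdsWithin : Set.Ioi (0 : ℝ) ∈ _)).exists
  obtain ⟨n, hn⟩ := exists_nat_one_div_lt hε0
  obtain ⟨r, hr, hden⟩ := Real.exists_rat_abs_sub_le_and_den_le τ n.succ_pos
  have hpos : (0 : ℝ) < r.den := by exact_mod_cast r.den_pos
  have h1 : (1 : ℝ) ≤ r.den := by exact_mod_cast r.den_pos
  have hden' : (r.den : ℝ) ≤ n + 1 := by exact_mod_cast hden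
  push_cast at hr
  refine ⟨r, hr.trans_lt ?_, ?_⟩
  · rw [sq]
    gcongr
    linarith
  · by_contra! hB
    have h2 := hε r hB
    rw [Real.dist_eq] at h2
    have h3 : 1 / ((n + 1 + 1 : ℝ) * r.den) ≤ 1 / (n + 1) := by
      gcongr
      nlinarith
    linarith

/-- If `d / (2 * q)` is the distance from `l * p / q` to `⌊l * p / q⌋ + 1 / 2`, then
`halfDist p q l` is the integer part of `(d - 1) / 2`, as a natural number. -/
def halfDist (p : ℤ) (q l : ℕ) : ℕ := ((|2 * ((l * p) % q) - q| - 1) / 2).toNat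

theorem not_dvd_of_two_mul_lt {p : ℤ} {q l : ℕ} (hpq : IsCoprime p (q : ℤ)) (hl : 1 ≤ l)
    (hlq : 2 * l < q) : ¬ (q : ℤ) ∣ 2 * (l * p) := by
  intro h
  have h1 : (q : ℤ) ∣ (2 * l : ℤ) := hpq.symm.dvd_of_dvd_mul_right (by rwa [mul_assoc])
  have := Int.le_of_dvd (by omega) h1
  omega

theorem two_mul_emod_ne {p : ℤ} {q l : ℕ} (hpq : IsCoprime p (q : ℤ)) (hl : 1 ≤ l)
    (hlq : 2 * l < q) : 2 * ((l * p) % q) ≠ (q : ℤ) ∧ (l * p) % q ≠ (0 : ℤ) := by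
  have h := not_dvd_of_two_mul_lt hpq hl hlq
  have e := Int.emod_add_mul_ediv (l * p) q
  constructor
  · intro h'
    exact h ⟨1 + 2 * (l * p / q), by linear_combination -2 * e + h'⟩
  · intro h'
    exact h (Dvd.dvd.mul_left (Int.dvd_of_emod_eq_zero h') 2)

theorem halfDist_injOn {p : ℤ} {q : ℕ} (hpq : IsCoprime p (q : ℤ)) :
    Set.InjOn (halfDist p q) {l | 1 ≤ l ∧ 2 * l < q} := by
  rintro l ⟨hl, hlq⟩ m ⟨hm, hmq⟩ h
  have ⟨hl1, hl2⟩ := two_mul_emod_ne hpq hl hlq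
  have ⟨hm1, hm2⟩ := two_mul_emod_ne hpq hm hmq
  have el := Int.emod_add_mul_ediv (l * p) q
  have em := Int.emod_add_mul_ediv (m * p) q
  unfold halfDist at h
  have hcase : ((l * p) % q : ℤ) = (m * p) % q ∨ ((l * p) % q : ℤ) + (m * p) % q = q := by
    generalize ((l * p) % q : ℤ) = a at *
    generalize ((m * p) % q : ℤ) = b at *
    rcases abs_cases (2 * a - q : ℤ) with ⟨h1, _⟩ | ⟨h1, _⟩ <;>
    rcases abs_cases (2 * b - q : ℤ) with ⟨h2, _⟩ | ⟨h2, _⟩ <;>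
    rw [h1, h2] at h <;> omega
  rcases hcase with hc | hc
  · have hd : (q : ℤ) ∣ ((l : ℤ) - m) * p :=
      ⟨l * p / q - m * p / q, by linear_combination -el + em + hc⟩
    have := Int.eq_zero_of_abs_lt_dvd (hpq.symm.dvd_of_dvd_mul_right hd)
      (by rw [abs_lt]; constructor <;> omega)
    omega
  · have hd : (q : ℤ) ∣ ((l : ℤ) + m) * p :=
      ⟨l * p / q + m * p / q + 1, by linear_combination -el - em + hc⟩
    have := Int.le_of_dvd (by omega) (hpq.symm.dvd_of_dvd_mul_right hd)
    omega

theorem abs_cos_lower_bound {τ : ℝ} {p : ℤ} {q l : ℕ} (hpq : IsCoprime p (q : ℤ))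
    (hτ : |τ - p / q| < 1 / (q : ℝ) ^ 2) (hl : 1 ≤ l) (hlq : 2 * l < q) :
    (2 * halfDist p q l * q + 1) / (q : ℝ) ^ 2 ≤ |cos (π * l * τ)| := by
  have hq : 0 < q := by omega
  have hqR : (0 : ℝ) < q := by exact_mod_cast hq
  have ⟨h1, h2⟩ := two_mul_emod_ne hpq hl hlq
  have e := Int.emod_add_mul_ediv (l * p) q
  have hr0 := Int.emod_nonneg (l * p) (by omega : (q : ℤ) ≠ 0)
  have hrq := Int.emod_lt_of_pos (l * p) (by omega : (0 : ℤ) < q)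
  unfold halfDist
  set r : ℤ := (l * p) % q
  set k : ℤ := (l * p) / q
  set d : ℤ := |2 * r - q| with hd
  have hd1 : 1 ≤ d := Int.one_le_abs (by omega)
  have hdq : d ≤ q - 2 := abs_le.2 ⟨by omega, by omega⟩
  have hj : 2 * (((d - 1) / 2).toNat : ℝ) ≤ d - 1 := by
    have : 2 * (((d - 1) / 2).toNat : ℤ) ≤ d - 1 := by omega
    exact_mod_cast this
  have hdqR : (d : ℝ) ≤ q - 2 := by exact_mod_cast hdq
  have hdR : (d : ℝ) = |(2 * r - q : ℝ)| := by rw [hd]; push_cast; rfl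
  have hlR : (2 * l + 1 : ℝ) ≤ q := by exact_mod_cast hlq
  have eR : (r : ℝ) + q * k = l * p := by exact_mod_cast e
  set y : ℝ := l * τ - k - 1 / 2 with hy
  have hyd : 2 * y = (2 * r - q) / q + 2 * l * (τ - p / q) := by
    rw [hy]
    field_simp
    linear_combination -2 * eR
  have hpert : |2 * l * (τ - p / q)| ≤ (q - 1) / (q : ℝ) ^ 2 := by
    rw [abs_mul, abs_of_nonneg (by positivity : (0 : ℝ) ≤ 2 * l), ← mul_one_div (_ - _)]
    exact mul_le_mul (by linarith) hτ.le (abs_nonneg _) (by linarith)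
  have hmain : |(2 * r - q : ℝ) / q| = d / q := by rw [abs_div, hdR, abs_of_pos hqR]
  have hup : |2 * y| ≤ 1 := by
    rw [hyd]
    refine (abs_add_le _ _).trans ?_
    rw [hmain]
    refine (add_le_add_right hpert _).trans ?_
    rw [div_add_div _ _ hqR.ne' (by positivity), div_le_one (by positivity)]
    nlinarith [mul_le_mul_of_nonneg_right hdqR (sq_nonneg (q : ℝ)), sq_nonneg (q : ℝ)]
  have hlow : d / q - (q - 1) / (q : ℝ) ^ 2 ≤ |2 * y| := by
    have := abs_sub_abs_le_abs_add ((2 * r - q : ℝ) / q) (2 * l * (τ - p / q))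
    rw [← hyd, hmain] at this
    linarith
  have hcos : |cos (π * l * τ)| = |sin (π * y)| := by
    have : π * l * τ = π * y + π / 2 + k * π := by rw [hy]; ring
    rw [this, cos_add_int_mul_pi, cos_add_pi_div_two, abs_mul]
    simp [abs_zpow]
  have hsin : |2 * y| ≤ |sin (π * y)| := by
    have hb : |π * y| ≤ π / 2 := by
      rw [abs_mul, abs_of_pos pi_pos]
      rw [abs_mul, abs_two] at hup
      nlinarith [pi_pos]
    convert mul_abs_le_abs_sin hb using 1
    rw [abs_mul, abs_mul, abs_of_pos pi_pos, abs_two]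
    field_simp
  rw [hcos]
  refine le_trans ?_ (hlow.trans hsin)
  rw [div_sub_div _ _ hqR.ne' (by positivity), div_le_div_iff₀ (by positivity) (by positivity)]
  have : 2 * (((d - 1) / 2).toNat : ℝ) * q ≤ (d - 1) * q :=
    mul_le_mul_of_nonneg_right hj hqR.le
  have h3 : (0 : ℝ) ≤ q ^ 3 := by positivity
  nlinarith [mul_le_mul_of_nonneg_right this h3]

theorem sq_add_one_le_four_mul_two_pow (n : ℕ) : n ^ 2 + 1 ≤ 4 * 2 ^ n := by
  induction n with
  | zero => norm_num
  | succ n ih =>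
    rw [pow_succ 2]
    rcases Nat.lt_or_ge n 2 with hn | hn
    · interval_cases n <;> norm_num
    · nlinarith

theorem prod_abs_inv_cos_le {τ : ℝ} {p : ℤ} {q N : ℕ} (hpq : IsCoprime p (q : ℤ))
    (hτ : |τ - p / q| < 1 / (q : ℝ) ^ 2) (hN : 2 ≤ N) (hq : q ≤ 2 * N) (hNq : 2 * (N - 1) < q) :
    ∏ l ∈ Ico 1 N, |(cos (π * l * τ))⁻¹| ≤ 16 * 6 ^ N := by
  have hqR : (0 : ℝ) < q := by exact_mod_cast (by omega : 0 < q)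
  obtain ⟨n, rfl⟩ : ∃ n, N = n + 2 := ⟨N - 2, by omega⟩
  set f : ℕ → ℝ := fun j => (2 * j * q + 1) / (q : ℝ) ^ 2 with hf
  have hmono : Monotone f := fun a b hab => by
    simp only [hf]
    gcongr
  have hinj : Set.InjOn (halfDist p q) (Ico 1 (n + 2) : Finset ℕ) :=
    (halfDist_injOn hpq).mono fun l hl => by
      simp only [coe_Ico, Set.mem_Ico] at hl
      exact ⟨hl.1, by omega⟩
  have hprod : ∏ i ∈ range (n + 1), f i ≤ ∏ l ∈ Ico 1 (n + 2), |cos (π * l * τ)| := by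
    calc _ = ∏ i ∈ range ((Ico 1 (n + 2)).image (halfDist p q)).card, f i := by
          rw [card_image_of_injOn hinj]; simp
      _ ≤ _ := prod_range_card_le_prod hmono (fun i => by positivity) _
      _ = ∏ l ∈ Ico 1 (n + 2), f (halfDist p q l) := prod_image hinj
      _ ≤ _ := prod_le_prod (fun i _ => by positivity) fun l hl => by
          rw [mem_Ico] at hl
          exact abs_cos_lower_bound hpq hτ hl.1 (by omega)
  have hpow : ((n + 2 : ℕ) : ℝ) ^ 2 ≤ 4 * 2 ^ (n + 2) := by
    exact_mod_cast (Nat.le_succ _).trans (sq_add_one_le_four_mul_two_pow (n + 2))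
  have hexp : ((n + 2 : ℕ) : ℝ) ^ n / n.factorial ≤ 3 ^ (n + 2) := by
    refine (pow_div_factorial_le_exp _ (by positivity) n).trans ?_
    rw [← exp_one_pow]
    exact pow_le_pow_left₀ (exp_pos 1).le exp_one_lt_three.le _
  set M : ℝ := ((n + 2 : ℕ) : ℝ) with hM
  have hM0 : 0 < M := by positivity
  have hqM : (q : ℝ) ≤ 2 * M := by rw [hM]; exact_mod_cast hq
  have hfac : (n.factorial : ℝ) / M ^ n * (1 / (q : ℝ) ^ 2) ≤ ∏ i ∈ range (n + 1), f i := by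
    rw [prod_range_succ']
    have h0 : f 0 = 1 / (q : ℝ) ^ 2 := by simp [hf]
    rw [h0]
    gcongr
    rw [← prod_range_add_one_eq_factorial, Nat.cast_prod, ← card_range n, ← prod_const,
      card_range, ← prod_div_distrib]
    refine prod_le_prod (fun i _ => by positivity) fun i _ => ?_
    simp only [hf]
    rw [div_le_div_iff₀ hM0 (by positivity)]
    have h2 := mul_le_mul_of_nonneg_left hqM (by positivity : (0 : ℝ) ≤ ((i + 1 : ℕ) : ℝ) * q)
    nlinarith
  have hpos : (0 : ℝ) < n.factorial / M ^ n * (1 / (q : ℝ) ^ 2) := by positivity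
  simp only [abs_inv]
  rw [prod_inv_distrib]
  calc _ ≤ ((n.factorial : ℝ) / M ^ n * (1 / (q : ℝ) ^ 2))⁻¹ := by
        exact inv_anti₀ hpos (hfac.trans hprod)
    _ = M ^ n / n.factorial * (q : ℝ) ^ 2 := by field_simp
    _ ≤ 3 ^ (n + 2) * (16 * 2 ^ (n + 2)) := by
        gcongr
        nlinarith
    _ = 16 * 6 ^ (n + 2) := by
        rw [show (6 : ℝ) = 3 * 2 by norm_num, mul_pow]
        ring

/-- For every positive irrational `τ` there exist a constant `C > 0` and a
strictly increasing sequence of positive integers `(N k)` such that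
`∏_{l=1}^{N k - 1} |sec (π l τ)| ≤ C * 6 ^ (N k)` for every `k ≥ 1`. -/
theorem stmt1 (τ : ℝ) (hirr : Irrational τ) (hpos : 0 < τ) :
    ∃ C : ℝ, 0 < C ∧ ∃ N : ℕ → ℕ, StrictMono N ∧
      ∀ k : ℕ, 1 ≤ k → 0 < N k ∧
        ∏ l ∈ Finset.Ico 1 (N k), |(Real.cos (π * l * τ))⁻¹| ≤ C * 6 ^ (N k) := by
  have hfreq : ∃ᶠ N : ℕ in atTop, 0 < N ∧
      ∏ l ∈ Finset.Ico 1 N, |(Real.cos (π * l * τ))⁻¹| ≤ 16 * 6 ^ N := by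
    rw [frequently_atTop]
    intro B
    obtain ⟨r, hr, hB⟩ := hirr.exists_rat_abs_sub_lt_and_lt_den (2 * B + 4)
    refine ⟨(r.den + 1) / 2, by omega, by omega, ?_⟩
    refine prod_abs_inv_cos_le (p := r.num) (q := r.den) r.isCoprime_num_den ?_
      (by omega) (by omega) (by omega)
    rwa [← Rat.cast_def]
  obtain ⟨N, hN, h⟩ := extraction_of_frequently_atTop hfreq
  exact ⟨16, by norm_num, N, hN, fun k _ => h k⟩
end

section
/- Let τ be a real number, let q be a positive integer and p an odd integer such that |q τ − p| < 2^{−q²} and cos(π q τ/2) ≠ 0. Then |sec(π q τ/2)| > 2^{q²}/π. -/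
open Real

/-- Near an odd multiple of `π / 2` the cosine is bounded by the distance to that zero. -/
theorem abs_cos_pi_mul_le (x : ℝ) (r : ℤ) : |cos (π * x)| ≤ π * |x - r - 1 / 2| := by
  have h : cos (π * x) = -((-1) ^ r * sin (π * (x - r - 1 / 2))) := by
    rw [← sin_add_int_mul_pi, ← cos_add_pi_div_two]
    congr 1
    ring
  rw [h, abs_neg, abs_mul, abs_zpow, abs_neg, abs_one, one_zpow, one_mul]
  calc |sin (π * (x - r - 1 / 2))| ≤ |π * (x - r - 1 / 2)| := abs_sin_le_abs
    _ = π * |x - r - 1 / 2| := by rw [abs_mul, abs_of_pos pi_pos]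

/-- If `q` is a positive integer, `p` is an odd integer,
`|q τ - p| < 2 ^ (-q²)` and `cos (π q τ / 2) ≠ 0`, then `|sec (π q τ / 2)| > 2 ^ (q²) / π`. -/
theorem stmt8 (τ : ℝ) (q : ℕ) (hq : 0 < q) (p : ℤ) (hp : Odd p)
    (happrox : |(q : ℝ) * τ - (p : ℝ)| < (2 : ℝ) ^ (-((q ^ 2 : ℕ) : ℤ)))
    (hcos : Real.cos (π * q * τ / 2) ≠ 0) :
    (2 : ℝ) ^ (q ^ 2) / π < |(Real.cos (π * q * τ / 2))⁻¹| := by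
  obtain ⟨r, rfl⟩ := hp
  rw [zpow_neg, zpow_natCast] at happrox
  have hdist : |q * τ / 2 - r - 1 / 2| = |(q : ℝ) * τ - ((2 * r + 1 : ℤ) : ℝ)| / 2 := by
    rw [← abs_two (α := ℝ), ← abs_div, abs_two]
    congr 1
    push_cast
    ring
  have hbound : |cos (π * q * τ / 2)| < π * ((2 : ℝ) ^ (q ^ 2))⁻¹ := by
    calc |cos (π * q * τ / 2)| = |cos (π * (q * τ / 2))| := by congr 2; ring
      _ ≤ π * |q * τ / 2 - r - 1 / 2| := abs_cos_pi_mul_le _ r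
      _ < π * ((2 : ℝ) ^ (q ^ 2))⁻¹ := by
        gcongr
        rw [hdist]
        exact (half_le_self (abs_nonneg _)).trans_lt happrox
  rw [abs_inv, ← inv_div, ← one_div, ← one_div]
  exact one_div_lt_one_div_of_lt (abs_pos.mpr hcos) (by rwa [div_eq_mul_inv])
end

section
/- There exists an irrational real number τ ∈ (1,2) whose continued fraction expansion τ = [a_0; a_1, a_2, …] satisfies a_{n+1} = 2^{q_n²} for all n ≥ −1, where q_n denotes the denominator of the n-th convergent of τ (with the convention q_{−1} = 0, so that a_0 = 1, a_1 = 2, a_2 = 2^4, a_3 = 2^{1089}, and in particular q_0 = 1, q_1 = 2, q_2 = 33). -/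
open Real

/-- A sequence bounded below by `1` is, up to any finite stage `N`, the sequence of partial
quotients of a sequence of complete quotients. -/
theorem exists_completeQuotients_lt (N : ℕ) (a : ℕ → ℤ) (ha : ∀ n, 1 ≤ a n) :
    ∃ g : ℕ → ℝ, (∀ n, (a n : ℝ) ≤ g n ∧ g n ≤ a n + 1) ∧
      ∀ n < N, g n * g (n + 1) = a n * g (n + 1) + 1 := by
  induction N generalizing a with
  | zero => exact ⟨fun n => a n, fun n => ⟨le_rfl, by linarith⟩, by simp⟩
  | succ N ih =>
    obtain ⟨g, hg, hrec⟩ := ih (fun n => a (n + 1)) fun n => ha (n + 1)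
    have h_one : (1 : ℝ) ≤ g 0 := le_trans (by exact_mod_cast ha 1) (hg 0).1
    have h_pos : 0 < g 0 := by linarith
    refine ⟨fun n => Nat.casesOn n (a 0 + (g 0)⁻¹) g, fun n => ?_, fun n hn => ?_⟩
    · cases n with
      | zero => exact ⟨by simpa using h_pos.le, by simpa using inv_le_one_of_one_le₀ h_one⟩
      | succ n => exact hg n
    · cases n with
      | zero => simp [add_mul, h_pos.ne']
      | succ n => exact hrec n (by lia)

/-- Every sequence of integers bounded below by `1` is the sequence of partial quotients of a
sequence of complete quotients. -/
theorem exists_completeQuotients (a : ℕ → ℤ) (ha : ∀ n, 1 ≤ a n) :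
    ∃ g : ℕ → ℝ, ∀ n, 1 < g n ∧ g n = a n + (g (n + 1))⁻¹ := by
  let K : ℕ → Set (ℕ → ℝ) := fun N =>
    (Set.univ.pi fun n => Set.Icc (a n : ℝ) (a n + 1)) ∩
      {g | ∀ n < N, g n * g (n + 1) = a n * g (n + 1) + 1}
  have h_compact : IsCompact (Set.univ.pi fun n => Set.Icc (a n : ℝ) (a n + 1)) :=
    isCompact_univ_pi fun n => isCompact_Icc
  have h_closed (N : ℕ) : IsClosed (K N) := by
    refine h_compact.isClosed.inter ?_
    simp only [Set.ofPred_forall]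
    exact isClosed_iInter fun n => isClosed_iInter fun _ =>
      isClosed_eq (by fun_prop) (by fun_prop)
  obtain ⟨g, hg⟩ := IsCompact.nonempty_iInter_of_sequence_nonempty_isCompact_isClosed K
    (fun N g hg => ⟨hg.1, fun n hn => hg.2 n (by lia)⟩)
    (fun N => by
      obtain ⟨g, hg, hrec⟩ := exists_completeQuotients_lt N a ha
      exact ⟨g, fun n _ => hg n, hrec⟩)
    (h_compact.of_isClosed_subset (h_closed 0) Set.inter_subset_left) h_closed
  have h_mem (N : ℕ) : g ∈ K N := Set.mem_iInter.1 hg N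
  have h_one_le (n : ℕ) : (1 : ℝ) ≤ a n := by exact_mod_cast ha n
  have h_pos (n : ℕ) : 0 < g n :=
    lt_of_lt_of_le one_pos ((h_one_le n).trans ((h_mem 0).1 n trivial).1)
  have h_rec (n : ℕ) : g n = a n + (g (n + 1))⁻¹ := by
    have h := (h_mem (n + 1)).2 n n.lt_succ_self
    have := (h_pos (n + 1)).ne'
    field_simp
    linarith
  refine ⟨g, fun n => ⟨?_, h_rec n⟩⟩
  have := inv_pos.2 (h_pos (n + 1))
  linarith [h_rec n, h_one_le n]

/-- An infinite sequence of complete quotients consists of irrational numbers. -/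
theorem irrational_of_completeQuotients {a : ℕ → ℤ} {g : ℕ → ℝ}
    (hg : ∀ n, 1 < g n ∧ g n = a n + (g (n + 1))⁻¹) (n : ℕ) : Irrational (g n) := by
  have key (d : ℕ) : 0 < d → ∀ (n : ℕ) (p : ℤ), g n * d ≠ p := by
    induction d using Nat.strong_induction_on with
    | _ d ih =>
      intro hd n p hp
      have hd' : (0 : ℝ) < d := by exact_mod_cast hd
      have h_inv_pos : 0 < (g (n + 1))⁻¹ := inv_pos.2 (one_pos.trans (hg (n + 1)).1)
      have h_inv_lt : (g (n + 1))⁻¹ < 1 := inv_lt_one_of_one_lt₀ (hg (n + 1)).1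
      have h_rem : (g (n + 1))⁻¹ * d = ((p - a n * d : ℤ) : ℝ) := by
        push_cast
        rw [← hp, (hg n).2]
        ring
      have h_rem_pos : 0 < p - a n * d := by
        have h : (0 : ℝ) < ((p - a n * d : ℤ) : ℝ) := h_rem ▸ mul_pos h_inv_pos hd'
        exact_mod_cast h
      have h_rem_lt : p - a n * d < d := by
        have h : ((p - a n * d : ℤ) : ℝ) < d := h_rem ▸ mul_lt_of_lt_one_left hd' h_inv_lt
        exact_mod_cast h
      obtain ⟨e, he⟩ := Int.eq_ofNat_of_zero_le h_rem_pos.le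
      rw [he] at h_rem h_rem_pos h_rem_lt
      refine ih e (by exact_mod_cast h_rem_lt) (by exact_mod_cast h_rem_pos) (n + 1) d ?_
      have h_ne : g (n + 1) ≠ 0 := (one_pos.trans (hg (n + 1)).1).ne'
      rw [Int.cast_natCast] at h_rem ⊢
      rw [← h_rem, mul_inv_cancel_left₀ h_ne]
  rintro ⟨r, hr⟩
  refine key r.den r.pos n r.num ?_
  rw [← hr]
  exact_mod_cast Rat.mul_den_eq_num r

theorem floor_of_completeQuotients {a : ℕ → ℤ} {g : ℕ → ℝ}
    (hg : ∀ n, 1 < g n ∧ g n = a n + (g (n + 1))⁻¹) (n : ℕ) : ⌊g n⌋ = a n := by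
  have h := (hg (n + 1)).1
  have h_pos := inv_pos.2 (one_pos.trans h)
  have h_lt := inv_lt_one_of_one_lt₀ h
  rw [Int.floor_eq_iff]
  constructor <;> linarith [(hg n).2]

theorem contFracQuot_of_completeQuotients {a : ℕ → ℤ} {g : ℕ → ℝ}
    (hg : ∀ n, 1 < g n ∧ g n = a n + (g (n + 1))⁻¹) (n : ℕ) : contFracQuot (g 0) n = g n := by
  induction n with
  | zero => rfl
  | succ n ih =>
    rw [contFracQuot, ih, Int.fract, floor_of_completeQuotients hg, inv_eq_iff_eq_inv]
    linarith [(hg n).2]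

/-- The denominators of the convergents of the number whose partial quotients are
`a (n + 1) = 2 ^ (q n) ^ 2`. -/
def twoPowSqDenom : ℕ → ℕ
  | 0 => 1
  | 1 => 2
  | n + 2 => 2 ^ twoPowSqDenom (n + 1) ^ 2 * twoPowSqDenom (n + 1) + twoPowSqDenom n

/-- The partial quotients `a 0 = 1` and `a (n + 1) = 2 ^ (q n) ^ 2`. -/
def twoPowSqPartialQuot : ℕ → ℤ
  | 0 => 1
  | n + 1 => 2 ^ twoPowSqDenom n ^ 2

theorem one_le_twoPowSqPartialQuot (n : ℕ) : 1 ≤ twoPowSqPartialQuot n := by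
  cases n with
  | zero => exact le_rfl
  | succ n => exact one_le_pow₀ one_le_two

theorem contFracQ_eq_twoPowSqDenom {x : ℝ} (hx : ∀ n, contFracA x n = twoPowSqPartialQuot n) :
    ∀ n, contFracQ x n = twoPowSqDenom n
  | 0 => by simp [contFracQ, twoPowSqDenom]
  | 1 => by simp [contFracQ, hx, twoPowSqPartialQuot, twoPowSqDenom]
  | n + 2 => by
    rw [contFracQ, contFracQ_eq_twoPowSqDenom hx (n + 1), contFracQ_eq_twoPowSqDenom hx n, hx,
      twoPowSqPartialQuot, twoPowSqDenom]
    push_cast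
    rfl

/-- There exists an irrational `τ ∈ (1,2)` whose continued fraction partial
quotients satisfy `a (n+1) = 2 ^ (q n)²` for all `n ≥ -1` (with `q (-1) = 0`, so `a 0 = 1`);
in particular `q 0 = 1`, `q 1 = 2`, `q 2 = 33`. -/
theorem stmt10 :
    ∃ τ : ℝ, Irrational τ ∧ 1 < τ ∧ τ < 2 ∧
      contFracA τ 0 = 1 ∧
      (∀ n : ℕ, contFracA τ (n + 1) = 2 ^ ((contFracQ τ n).toNat ^ 2)) ∧
      contFracQ τ 0 = 1 ∧ contFracQ τ 1 = 2 ∧ contFracQ τ 2 = 33 := by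
  obtain ⟨g, hg⟩ := exists_completeQuotients twoPowSqPartialQuot one_le_twoPowSqPartialQuot
  have hA (n : ℕ) : contFracA (g 0) n = twoPowSqPartialQuot n := by
    rw [contFracA, contFracQuot_of_completeQuotients hg, floor_of_completeQuotients hg]
  have hQ := contFracQ_eq_twoPowSqDenom hA
  refine ⟨g 0, irrational_of_completeQuotients hg 0, (hg 0).1, ?_, hA 0, fun n => ?_, ?_, ?_, ?_⟩
  · have h := inv_lt_one_of_one_lt₀ (hg 1).1
    have h_eq := (hg 0).2
    norm_num [twoPowSqPartialQuot] at h_eq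
    linarith
  · rw [hA, hQ, Int.toNat_natCast, twoPowSqPartialQuot]
  · simp [hQ, twoPowSqDenom]
  · simp [hQ, twoPowSqDenom]
  · simp [hQ, twoPowSqDenom]
end

section
/- There exists an irrational real number α ∈ (1,2) such that for every real constant B > 0 and every real constant A > 0 there exists an integer k ≥ 1 with ∏_{l=1}^{k} |sec(π l/α)| > B · A^k; in other words, for this α the sequence of products ∏_{l=1}^{k} |sec(π l/α)| is not bounded above by any exponential function of k. -/
open Real Finset

/-- The half-odd multiples `(j + 1/2) / k` are dense, so `cos (π k θ)` can be made to vanish for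
`θ` near any given real. -/
lemma exists_cos_nat_mul_eq_zero_near (x ε : ℝ) (hε : 0 < ε) :
    ∃ θ : ℝ, |θ - x| < ε ∧ ∃ k : ℕ, 1 ≤ k ∧ Real.cos (π * k * θ) = 0 := by
  obtain ⟨m, hm⟩ := exists_nat_one_div_lt hε
  have hk : (0 : ℝ) < (m : ℝ) + 1 := by positivity
  refine ⟨((⌊((m : ℝ) + 1) * x⌋ : ℝ) + 1 / 2) / (m + 1), ?_, m + 1, by omega, ?_⟩
  · have h1 := Int.floor_le (((m : ℝ) + 1) * x)
    have h2 := Int.lt_floor_add_one (((m : ℝ) + 1) * x)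
    refine lt_trans ?_ hm
    rw [div_sub' hk.ne', abs_div, abs_of_pos hk]
    gcongr
    rw [abs_lt]
    constructor <;> linarith
  · rw [Real.cos_eq_zero_iff]
    refine ⟨⌊((m : ℝ) + 1) * x⌋, ?_⟩
    push_cast
    field_simp

lemma isOpen_dense_exists_mul_abs_cos_lt_one (c : ℕ → ℝ) :
    IsOpen {θ : ℝ | ∃ k : ℕ, 1 ≤ k ∧ c k * |Real.cos (π * k * θ)| < 1} ∧
      Dense {θ : ℝ | ∃ k : ℕ, 1 ≤ k ∧ c k * |Real.cos (π * k * θ)| < 1} := by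
  constructor
  · simp only [Set.ofPred_exists, Set.ofPred_and]
    refine isOpen_iUnion fun k => isOpen_const.inter (isOpen_lt ?_ continuous_const)
    fun_prop
  · rw [Metric.dense_iff]
    intro x ε hε
    obtain ⟨θ, hθ, k, hk, h0⟩ := exists_cos_nat_mul_eq_zero_near x ε hε
    exact ⟨θ, by simpa [Real.dist_eq] using hθ, k, hk, by simp [h0]⟩

lemma Irrational.cos_pi_mul_nat_mul_ne_zero {θ : ℝ} (hθ : Irrational θ) {k : ℕ} (hk : 1 ≤ k) :
    Real.cos (π * k * θ) ≠ 0 := by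
  intro h
  obtain ⟨j, hj⟩ := Real.cos_eq_zero_iff.1 h
  have hk0 : (k : ℝ) ≠ 0 := by positivity
  refine hθ ⟨(2 * j + 1) / (2 * k), ?_⟩
  push_cast
  rw [div_eq_iff (by positivity)]
  apply mul_left_cancel₀ Real.pi_ne_zero
  linarith

/-- There exists an irrational `α ∈ (1,2)` such that for all constants
`B > 0` and `A > 0` there is an integer `k ≥ 1` with
`∏_{l=1}^{k} |sec (π l / α)| > B * A ^ k`; i.e. these products are not bounded above
by any exponential function of `k`. -/
theorem stmt11 :
    ∃ α : ℝ, Irrational α ∧ 1 < α ∧ α < 2 ∧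
      ∀ B : ℝ, 0 < B → ∀ A : ℝ, 0 < A → ∃ k : ℕ, 1 ≤ k ∧
        B * A ^ k < ∏ l ∈ Finset.Icc 1 k, |(Real.cos (π * l / α))⁻¹| := by
  have hres : ∀ᶠ θ : ℝ in residual ℝ, Irrational θ ∧
      ∀ n : ℕ, ∃ k : ℕ, 1 ≤ k ∧ ((n : ℝ) * (n : ℝ) ^ k) * |Real.cos (π * k * θ)| < 1 := by
    refine eventually_residual_irrational.and (eventually_countable_forall.2 fun n => ?_)
    obtain ⟨ho, hd⟩ := isOpen_dense_exists_mul_abs_cos_lt_one fun k => (n : ℝ) * (n : ℝ) ^ k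
    exact residual_of_dense_open ho hd
  obtain ⟨θ, ⟨hirr, hsmall⟩, h1, h2⟩ :=
    (dense_of_mem_residual hres).exists_mem_open (isOpen_Ioo (a := (1 / 2 : ℝ)) (b := 1))
      (Set.nonempty_Ioo.2 (by norm_num))
  have hpos : 0 < θ := by linarith
  refine ⟨θ⁻¹, hirr.inv, (one_lt_inv₀ hpos).2 h2, ?_, fun B hB A hA => ?_⟩
  · rw [inv_lt_comm₀ hpos two_pos]
    linarith
  obtain ⟨n, hn⟩ := exists_nat_ge (max A B)
  obtain ⟨k, hk, hlt⟩ := hsmall n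
  refine ⟨k, hk, ?_⟩
  simp only [div_inv_eq_mul]
  have hcos : ∀ l : ℕ, 1 ≤ l → 0 < |Real.cos (π * l * θ)| := fun l hl =>
    abs_pos.2 (hirr.cos_pi_mul_nat_mul_ne_zero hl)
  calc B * A ^ k ≤ (n : ℝ) * (n : ℝ) ^ k := by
        gcongr
        · exact (le_max_right _ _).trans hn
        · exact (le_max_left _ _).trans hn
    _ < |(Real.cos (π * k * θ))⁻¹| := by
        rw [abs_inv, ← one_div]
        exact (lt_div_iff₀ (hcos k hk)).2 hlt
    _ ≤ ∏ l ∈ Finset.Icc 1 k, |(Real.cos (π * l * θ))⁻¹| := by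
        rw [← Finset.mul_prod_erase _ _ (Finset.mem_Icc.2 ⟨hk, le_rfl⟩)]
        refine le_mul_of_one_le_right (abs_nonneg _) ?_
        rw [← Finset.prod_const_one (s := (Finset.Icc 1 k).erase k)]
        refine Finset.prod_le_prod (fun _ _ => zero_le_one) fun l hl => ?_
        rw [abs_inv]
        exact (one_le_inv₀ (hcos l (Finset.mem_Icc.1 (Finset.mem_of_mem_erase hl)).1)).2
          (Real.abs_cos_le_one _)
end
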